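/- Let γ > 0, let m_1 = m_1(n) be integers with m_1 = o(n log n), set t = ⌊γ n log n⌋ and T = T(m_1, t). With high probability, the König process satisfies both of the following. (1) No set S ⊆ V with |S| ≥ n/3 and W_T(S) ≥ 150 n²/t is an independent set in G_{m_1+t}. (2) For every constant a ≥ 10 and every set U ⊆ V with |U| = n/2 and W_T(U) ≥ n/2 − a n²/t, the number of indices m with m_1 + 1 ≤ m ≤ m_1 + t such that e_m is incident to U and e_m is rejected is at most 5an. -/

import Mathlib

open scoped Classical

noncomputable section

/-- `M` is a matching in the graph `G`: a set of edges of `G` that are pairwise disjoint. -/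
def IsMatchingOn {n : ℕ} (G : SimpleGraph (Fin n)) (M : Finset (Sym2 (Fin n))) : Prop :=
  (∀ e ∈ M, e ∈ G.edgeSet) ∧
  ∀ e ∈ M, ∀ f ∈ M, e ≠ f → ∀ v : Fin n, v ∈ e → v ∉ f

/-- ν(G): the maximum size of a matching of `G`. -/
def matchNum {n : ℕ} (G : SimpleGraph (Fin n)) : ℕ :=
  sSup {k | ∃ M : Finset (Sym2 (Fin n)), IsMatchingOn G M ∧ M.card = k}

/-- `C` is a vertex cover of `G`. -/
def IsVertexCover {n : ℕ} (G : SimpleGraph (Fin n)) (C : Finset (Fin n)) : Prop :=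
  ∀ e ∈ G.edgeSet, ∃ v ∈ C, v ∈ e

/-- τ(G): the minimum size of a vertex cover of `G`. -/
def coverNum {n : ℕ} (G : SimpleGraph (Fin n)) : ℕ :=
  sInf {k | ∃ C : Finset (Fin n), IsVertexCover G C ∧ C.card = k}

/-- `G` is a König graph: ν(G) = τ(G). -/
def IsKonig {n : ℕ} (G : SimpleGraph (Fin n)) : Prop := matchNum G = coverNum G

/-- An ordering `e_1, …, e_N` (0-indexed: `σ 0, …, σ (N-1)`) of the `N = n(n-1)/2` edges of
the complete graph on `Fin n`: an injective function from `Fin N` to non-diagonal elements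
of `Sym2 (Fin n)`, hence a bijection onto the edge set of `K_n`. -/
def EdgeOrdering (n : ℕ) : Type :=
  {σ : Fin (n*(n-1)/2) → Sym2 (Fin n) // Function.Injective σ ∧ ∀ i, ¬ (σ i).IsDiag}

/-- The König process: `KonigProc σ m` is the graph `G_m`, where `G_0 = ⊥` and
`G_{m+1} = G_m + e_{m+1}` if that graph is König, `G_{m+1} = G_m` otherwise. -/
def KonigProc {n : ℕ} (σ : EdgeOrdering n) : ℕ → SimpleGraph (Fin n)
  | 0 => ⊥
  | m+1 =>
    if h : m < n*(n-1)/2 then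
      (if IsKonig (KonigProc σ m ⊔ SimpleGraph.fromEdgeSet {σ.1 ⟨m, h⟩})
        then KonigProc σ m ⊔ SimpleGraph.fromEdgeSet {σ.1 ⟨m, h⟩}
        else KonigProc σ m)
    else KonigProc σ m

/-- The probability of an event `A` under the uniformly random edge ordering. -/
def Pr (n : ℕ) (A : EdgeOrdering n → Prop) : ℝ :=
  (Nat.card {σ : EdgeOrdering n // A σ} : ℝ) / (Nat.card (EdgeOrdering n) : ℝ)

/-- `D(G)`: the set of vertices belonging to at least one minimum vertex cover of `G`. -/
def minCoverUnion {n : ℕ} (G : SimpleGraph (Fin n)) : Finset (Fin n) :=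
  Finset.univ.filter (fun v =>
    ∃ C : Finset (Fin n), IsVertexCover G C ∧ C.card = coverNum G ∧ v ∈ C)

section Konig

variable {n : ℕ}

lemma IsMatchingOn.card_le_of_isVertexCover {G : SimpleGraph (Fin n)}
    {M : Finset (Sym2 (Fin n))} {C : Finset (Fin n)} (hM : IsMatchingOn G M)
    (hC : IsVertexCover G C) : M.card ≤ C.card := by
  choose f hf using fun e : M => hC e.1 (hM.1 e.1 e.2)
  rw [← Finset.card_attach]
  refine Finset.card_le_card_of_injOn f (fun e _ => (hf e).1) ?_
  intro e _ e' _ hee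
  by_contra hne
  exact hM.2 e.1 e.2 e'.1 e'.2 (fun h => hne (Subtype.ext h)) (f e) (hf e).2 (hee ▸ (hf e').2)

lemma exists_isVertexCover_card_eq_coverNum (G : SimpleGraph (Fin n)) :
    ∃ C, IsVertexCover G C ∧ C.card = coverNum G := by
  have hne : {k | ∃ C : Finset (Fin n), IsVertexCover G C ∧ C.card = k}.Nonempty := by
    refine ⟨_, Finset.univ, fun e _ => ?_, rfl⟩
    induction e with
    | _ u v => exact ⟨u, Finset.mem_univ _, Sym2.mem_mk_left u v⟩
  exact Nat.sInf_mem hne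

lemma IsVertexCover.coverNum_le {G : SimpleGraph (Fin n)} {C : Finset (Fin n)}
    (hC : IsVertexCover G C) : coverNum G ≤ C.card :=
  Nat.sInf_le ⟨C, hC, rfl⟩

lemma matchNum_bddAbove (G : SimpleGraph (Fin n)) :
    BddAbove {k | ∃ M : Finset (Sym2 (Fin n)), IsMatchingOn G M ∧ M.card = k} := by
  obtain ⟨C, hC, -⟩ := exists_isVertexCover_card_eq_coverNum G
  refine ⟨C.card, ?_⟩
  rintro _ ⟨M, hM, rfl⟩
  exact hM.card_le_of_isVertexCover hC

lemma exists_isMatchingOn_card_eq_matchNum (G : SimpleGraph (Fin n)) :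
    ∃ M, IsMatchingOn G M ∧ M.card = matchNum G :=
  Nat.sSup_mem (s := {k | ∃ M : Finset (Sym2 (Fin n)), IsMatchingOn G M ∧ M.card = k})
    ⟨0, ∅, ⟨by simp, by simp⟩, rfl⟩ (matchNum_bddAbove G)

lemma matchNum_le_coverNum (G : SimpleGraph (Fin n)) : matchNum G ≤ coverNum G := by
  obtain ⟨C, hC, hCc⟩ := exists_isVertexCover_card_eq_coverNum G
  obtain ⟨M, hM, hMc⟩ := exists_isMatchingOn_card_eq_matchNum G
  rw [← hCc, ← hMc]
  exact hM.card_le_of_isVertexCover hC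

lemma matchNum_mono {G H : SimpleGraph (Fin n)} (h : G ≤ H) : matchNum G ≤ matchNum H := by
  obtain ⟨M, hM, hMc⟩ := exists_isMatchingOn_card_eq_matchNum G
  rw [← hMc]
  exact le_csSup (matchNum_bddAbove H)
    ⟨M, ⟨fun e he => SimpleGraph.edgeSet_mono h (hM.1 e he), hM.2⟩, rfl⟩

lemma isKonig_bot : IsKonig (⊥ : SimpleGraph (Fin n)) := by
  have h : IsVertexCover (⊥ : SimpleGraph (Fin n)) ∅ := by simp [IsVertexCover]
  have h1 := h.coverNum_le
  have h2 := matchNum_le_coverNum (⊥ : SimpleGraph (Fin n))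
  simp only [Finset.card_empty] at h1
  unfold IsKonig
  omega

/-- Adding a pair that meets some minimum vertex cover preserves the König property. -/
lemma IsKonig.sup_fromEdgeSet {G : SimpleGraph (Fin n)} (hG : IsKonig G) {e : Sym2 (Fin n)}
    {v : Fin n} (hve : v ∈ e) (hv : v ∈ minCoverUnion G) :
    IsKonig (G ⊔ SimpleGraph.fromEdgeSet {e}) := by
  obtain ⟨C, hC, hCc, hvC⟩ := (Finset.mem_filter.1 hv).2
  have hcov : IsVertexCover (G ⊔ SimpleGraph.fromEdgeSet {e}) C := by
    intro f hf
    rw [SimpleGraph.edgeSet_sup, SimpleGraph.edgeSet_fromEdgeSet] at hf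
    rcases hf with hf | hf
    · exact hC f hf
    · obtain rfl : f = e := hf.1
      exact ⟨v, hvC, hve⟩
  have h1 := hcov.coverNum_le
  have h2 := matchNum_mono (le_sup_left : G ≤ G ⊔ SimpleGraph.fromEdgeSet {e})
  have h3 := matchNum_le_coverNum (G ⊔ SimpleGraph.fromEdgeSet {e})
  unfold IsKonig at *
  omega

lemma isKonig_konigProc (σ : EdgeOrdering n) (m : ℕ) : IsKonig (KonigProc σ m) := by
  induction m with
  | zero => exact isKonig_bot
  | succ m ih =>
    unfold KonigProc
    split_ifs <;> assumption

lemma konigProc_mono (σ : EdgeOrdering n) : Monotone (KonigProc σ) := by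
  refine monotone_nat_of_le_succ fun m => ?_
  conv_rhs => unfold KonigProc
  split_ifs
  · exact le_sup_left
  · exact le_rfl
  · exact le_rfl

lemma konigProc_congr {σ ρ : EdgeOrdering n} {m : ℕ}
    (h : ∀ j : Fin (n*(n-1)/2), j.1 < m → σ.1 j = ρ.1 j) : KonigProc σ m = KonigProc ρ m := by
  induction m with
  | zero => rfl
  | succ m ih =>
    unfold KonigProc
    rw [ih fun j hj => h j (by omega)]
    by_cases hm : m < n*(n-1)/2
    · simp only [hm, dite_true, h ⟨m, hm⟩ (Nat.lt_succ_self m)]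
    · simp only [hm, dite_false]

end Konig

section Exposure

variable {n : ℕ}

instance : Finite (EdgeOrdering n) :=
  inferInstanceAs (Finite {σ : Fin (n*(n-1)/2) → Sym2 (Fin n) //
    Function.Injective σ ∧ ∀ i, ¬ (σ i).IsDiag})

instance : Fintype (EdgeOrdering n) := Fintype.ofFinite _

lemma card_not_isDiag : Fintype.card {e : Sym2 (Fin n) // ¬ e.IsDiag} = n*(n-1)/2 := by
  rw [Sym2.card_subtype_not_diag, Fintype.card_fin, Nat.choose_two_right]

instance : Nonempty (EdgeOrdering n) := by
  let f := (Fintype.equivFinOfCardEq (card_not_isDiag (n := n))).symm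
  exact ⟨⟨fun i => (f i).1, fun i j h => f.injective (Subtype.ext h), fun i => (f i).2⟩⟩

lemma EdgeOrdering.exists_eq (σ : EdgeOrdering n) {e : Sym2 (Fin n)} (he : ¬ e.IsDiag) :
    ∃ i, σ.1 i = e := by
  let g : Fin (n*(n-1)/2) → {e : Sym2 (Fin n) // ¬ e.IsDiag} := fun i => ⟨σ.1 i, σ.2.2 i⟩
  have hg : Function.Injective g := fun i j h => σ.2.1 (congrArg Subtype.val h)
  have hb : Function.Bijective g :=
    (Fintype.bijective_iff_injective_and_card g).2 ⟨hg, by rw [card_not_isDiag, Fintype.card_fin]⟩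
  obtain ⟨i, hi⟩ := hb.2 ⟨e, he⟩
  exact ⟨i, congrArg Subtype.val hi⟩

/-- Exchange the pairs offered at positions `a` and `b`. -/
def EdgeOrdering.exchange (a b : Fin (n*(n-1)/2)) : EdgeOrdering n ≃ EdgeOrdering n where
  toFun σ := ⟨σ.1 ∘ Equiv.swap a b, σ.2.1.comp (Equiv.injective _), fun i => σ.2.2 _⟩
  invFun σ := ⟨σ.1 ∘ Equiv.swap a b, σ.2.1.comp (Equiv.injective _), fun i => σ.2.2 _⟩
  left_inv σ := Subtype.ext (by funext i; simp)
  right_inv σ := Subtype.ext (by funext i; simp)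

lemma EdgeOrdering.exchange_apply (a b i : Fin (n*(n-1)/2)) (σ : EdgeOrdering n) :
    (EdgeOrdering.exchange a b σ).1 i = σ.1 (Equiv.swap a b i) := rfl

lemma swap_val_lt {N i : ℕ} {a b j : Fin N} (ha : i ≤ a.1) (hb : i ≤ b.1) (hj : j.1 < i) :
    Equiv.swap a b j = j :=
  Equiv.swap_apply_of_ne_of_ne (by rintro rfl; omega) (by rintro rfl; omega)

lemma le_swap_val {N i : ℕ} {a b j : Fin N} (ha : i ≤ a.1) (hb : i ≤ b.1) (hj : i ≤ j.1) :
    i ≤ (Equiv.swap a b j).1 := by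
  rw [Equiv.swap_apply_def]
  split_ifs <;> assumption

lemma konigProc_exchange {i : ℕ} {a b : Fin (n*(n-1)/2)} (ha : i ≤ a.1) (hb : i ≤ b.1)
    (σ : EdgeOrdering n) : KonigProc (EdgeOrdering.exchange a b σ) i = KonigProc σ i :=
  konigProc_congr fun j hj => by rw [EdgeOrdering.exchange_apply, swap_val_lt ha hb hj]

/-- The number of pairs not offered before step `i` that lie in the target set `K (G_i)`. -/
def remainingCount (K : SimpleGraph (Fin n) → Set (Sym2 (Fin n))) (σ : EdgeOrdering n) (i : ℕ) :
    ℕ :=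
  (Finset.univ.filter fun j : Fin (n*(n-1)/2) => i ≤ j.1 ∧ σ.1 j ∈ K (KonigProc σ i)).card

/-- The conditional probability that the pair offered in step `i` lies in `K (G_i)`. -/
def hitProb (K : SimpleGraph (Fin n) → Set (Sym2 (Fin n))) (σ : EdgeOrdering n) (i : ℕ) : ℝ :=
  remainingCount K σ i / (((n*(n-1)/2 : ℕ) : ℝ) - i)

/-- The pair offered in step `i` lies in the target set `K (G_i)`. -/
def Hit (K : SimpleGraph (Fin n) → Set (Sym2 (Fin n))) (σ : EdgeOrdering n) (i : ℕ) : Prop :=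
  ∃ h : i < n*(n-1)/2, σ.1 ⟨i, h⟩ ∈ K (KonigProc σ i)

/-- The exponential supermartingale that multiplies by `w` at every hit. -/
def hitWeight (w : ℝ) (K : SimpleGraph (Fin n) → Set (Sym2 (Fin n))) (σ : EdgeOrdering n)
    (s : Finset ℕ) : ℝ :=
  ∏ i ∈ s, (if Hit K σ i then w else 1) * Real.exp (-((w - 1) * hitProb K σ i))

variable {K : SimpleGraph (Fin n) → Set (Sym2 (Fin n))}

lemma remainingCount_exchange {i : ℕ} {a b : Fin (n*(n-1)/2)} (ha : i ≤ a.1) (hb : i ≤ b.1)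
    (σ : EdgeOrdering n) :
    remainingCount K (EdgeOrdering.exchange a b σ) i = remainingCount K σ i := by
  refine Finset.card_equiv (Equiv.swap a b) fun j => ?_
  simp only [Finset.mem_filter, Finset.mem_univ, true_and, konigProc_exchange ha hb,
    EdgeOrdering.exchange_apply]
  refine and_congr_left fun _ => ⟨fun h => le_swap_val ha hb h, fun h => ?_⟩
  simpa using le_swap_val ha hb h

lemma hitProb_exchange {i : ℕ} {a b : Fin (n*(n-1)/2)} (ha : i ≤ a.1) (hb : i ≤ b.1)
    (σ : EdgeOrdering n) : hitProb K (EdgeOrdering.exchange a b σ) i = hitProb K σ i := by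
  rw [hitProb, remainingCount_exchange ha hb, hitProb]

lemma hit_exchange {i : ℕ} {a b : Fin (n*(n-1)/2)} (ha : i < a.1) (hb : i < b.1)
    (σ : EdgeOrdering n) : Hit K (EdgeOrdering.exchange a b σ) i ↔ Hit K σ i := by
  refine exists_congr fun h => ?_
  rw [konigProc_exchange ha.le hb.le, EdgeOrdering.exchange_apply,
    swap_val_lt (i := i + 1) ha hb (Nat.lt_succ_self i)]

lemma hitWeight_exchange {w : ℝ} {s : Finset ℕ} {a b : Fin (n*(n-1)/2)}
    (hs : ∀ i ∈ s, i < a.1 ∧ i < b.1) (σ : EdgeOrdering n) :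
    hitWeight w K (EdgeOrdering.exchange a b σ) s = hitWeight w K σ s := by
  refine Finset.prod_congr rfl fun i hi => ?_
  rw [hitProb_exchange (hs i hi).1.le (hs i hi).2.le]
  simp only [hit_exchange (hs i hi).1 (hs i hi).2]

lemma hitWeight_nonneg {w : ℝ} (hw : 0 ≤ w) (σ : EdgeOrdering n) (s : Finset ℕ) :
    0 ≤ hitWeight w K σ s := by
  refine Finset.prod_nonneg fun i _ => mul_nonneg ?_ (Real.exp_nonneg _)
  split_ifs
  · exact hw
  · exact zero_le_one

lemma sum_mul_hit_eq {m : ℕ} (hm : m < n*(n-1)/2) (w : ℝ) (A : EdgeOrdering n → ℝ)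
    (hA : ∀ j : Fin (n*(n-1)/2), m ≤ j.1 → ∀ σ,
      A (EdgeOrdering.exchange ⟨m, hm⟩ j σ) = A σ) :
    ∑ σ, A σ * (if Hit K σ m then w else 1) = ∑ σ, A σ * (1 + (w - 1) * hitProb K σ m) := by
  set J := Finset.univ.filter fun j : Fin (n*(n-1)/2) => m ≤ j.1 with hJ
  have hJc : (J.card : ℝ) = ((n*(n-1)/2 : ℕ) : ℝ) - m := by
    have : J = Finset.Ici (⟨m, hm⟩ : Fin (n*(n-1)/2)) := by
      ext j; simp [hJ, Fin.le_def]
    rw [this, Fin.card_Ici, Nat.cast_sub hm.le]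
  have hpos : (0 : ℝ) < ((n*(n-1)/2 : ℕ) : ℝ) - m := by
    have : (m : ℝ) < ((n*(n-1)/2 : ℕ) : ℝ) := by exact_mod_cast hm
    linarith
  have hsym : ∀ j ∈ J, ∑ σ, A σ * (if Hit K σ m then w else 1) =
      ∑ σ, A σ * (if σ.1 j ∈ K (KonigProc σ m) then w else 1) := by
    intro j hj
    have hj' : m ≤ j.1 := (Finset.mem_filter.1 hj).2
    rw [← Equiv.sum_comp (EdgeOrdering.exchange ⟨m, hm⟩ j)]
    refine Finset.sum_congr rfl fun σ _ => ?_
    have : Hit K (EdgeOrdering.exchange ⟨m, hm⟩ j σ) m ↔ σ.1 j ∈ K (KonigProc σ m) := by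
      unfold Hit
      rw [konigProc_exchange le_rfl hj']
      simp [EdgeOrdering.exchange_apply, hm]
    rw [hA j hj']
    simp only [this]
  have hsum := Finset.sum_congr rfl hsym
  rw [Finset.sum_const, nsmul_eq_mul, Finset.sum_comm, hJc] at hsum
  refine mul_left_cancel₀ hpos.ne' ?_
  rw [hsum, Finset.mul_sum]
  refine Finset.sum_congr rfl fun σ _ => ?_
  rw [← Finset.mul_sum]
  have hind : ∀ j : Fin (n*(n-1)/2), (if σ.1 j ∈ K (KonigProc σ m) then w else 1) =
      1 + (w - 1) * (if σ.1 j ∈ K (KonigProc σ m) then 1 else 0) := by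
    intro j; split_ifs <;> ring
  have hcount : ∑ j ∈ J, (if σ.1 j ∈ K (KonigProc σ m) then (1 : ℝ) else 0) =
      (((n*(n-1)/2 : ℕ) : ℝ) - m) * hitProb K σ m := by
    rw [hitProb, mul_div_cancel₀ _ hpos.ne', Finset.sum_boole, remainingCount, hJ,
      Finset.filter_filter]
  rw [Finset.sum_congr rfl fun j _ => hind j, Finset.sum_add_distrib, ← Finset.mul_sum, hcount,
    Finset.sum_const, nsmul_eq_mul, hJc]
  ring

lemma sum_hitWeight_le {w : ℝ} (hw : 0 ≤ w) (m₁ t : ℕ) (hN : m₁ + t ≤ n*(n-1)/2) :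
    ∑ σ : EdgeOrdering n, hitWeight w K σ (Finset.Ico m₁ (m₁ + t)) ≤
      Fintype.card (EdgeOrdering n) := by
  induction t with
  | zero => simp [hitWeight]
  | succ t ih =>
    have hm : m₁ + t < n*(n-1)/2 := by omega
    refine le_trans ?_ (ih hm.le)
    have hsplit : ∀ σ : EdgeOrdering n, hitWeight w K σ (Finset.Ico m₁ (m₁ + (t + 1))) =
        (hitWeight w K σ (Finset.Ico m₁ (m₁ + t)) *
          Real.exp (-((w - 1) * hitProb K σ (m₁ + t)))) *
          (if Hit K σ (m₁ + t) then w else 1) := by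
      intro σ
      rw [hitWeight, ← add_assoc, Finset.prod_Ico_succ_top (Nat.le_add_right m₁ t), hitWeight]
      ring
    rw [Finset.sum_congr rfl fun σ _ => hsplit σ, sum_mul_hit_eq hm]
    · refine Finset.sum_le_sum fun σ _ => ?_
      rw [mul_assoc]
      refine mul_le_of_le_one_right (hitWeight_nonneg hw _ _) ?_
      rw [Real.exp_neg, inv_mul_le_one₀ (Real.exp_pos _), add_comm]
      exact Real.add_one_le_exp _
    · intro j hj σ
      rw [hitProb_exchange le_rfl hj, hitWeight_exchange]
      intro i hi
      have := (Finset.mem_Ico.1 hi).2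
      exact ⟨this, lt_of_lt_of_le this hj⟩

lemma hitProb_nonneg {i : ℕ} (hi : i ≤ n*(n-1)/2) (σ : EdgeOrdering n) : 0 ≤ hitProb K σ i := by
  refine div_nonneg (Nat.cast_nonneg _) (sub_nonneg.2 ?_)
  exact_mod_cast hi

lemma remainingCount_eq {i : ℕ} (hi : i < n*(n-1)/2) (σ : EdgeOrdering n) :
    (remainingCount K σ i : ℝ) = hitProb K σ i * (((n*(n-1)/2 : ℕ) : ℝ) - i) := by
  have : (i : ℝ) < ((n*(n-1)/2 : ℕ) : ℝ) := by exact_mod_cast hi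
  rw [hitProb, div_mul_cancel₀ _ (by linarith)]

lemma hitWeight_eq (w : ℝ) (σ : EdgeOrdering n) (s : Finset ℕ) :
    hitWeight w K σ s = w ^ (s.filter (Hit K σ)).card *
      Real.exp (-((w - 1) * ∑ i ∈ s, hitProb K σ i)) := by
  rw [hitWeight, Finset.prod_mul_distrib, ← Real.exp_sum, Finset.prod_ite,
    Finset.prod_const, Finset.prod_const_one, mul_one, Finset.mul_sum, Finset.sum_neg_distrib]

end Exposure

section Targets

variable {n : ℕ}

/-- Pairs inside `S` that meet some minimum vertex cover within `S`. -/
def insidePairs (S : Finset (Fin n)) (G : SimpleGraph (Fin n)) : Set (Sym2 (Fin n)) :=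
  {e | ∃ u ∈ S ∩ minCoverUnion G, ∃ v ∈ S, u ≠ v ∧ e = s(u, v)}

/-- Pairs with an endpoint in `U` that lies in no minimum vertex cover. -/
def uncoveredPairs (U : Finset (Fin n)) (G : SimpleGraph (Fin n)) : Set (Sym2 (Fin n)) :=
  {e | ∃ v ∈ U \ minCoverUnion G, v ∈ e}

lemma sum_card_filter_mem_minCoverUnion (σ : EdgeOrdering n) (S : Finset (Fin n))
    (T : Finset ℕ) :
    ∑ v ∈ S, (T.filter (fun m => v ∈ minCoverUnion (KonigProc σ m))).card =
      ∑ m ∈ T, (S ∩ minCoverUnion (KonigProc σ m)).card := by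
  simp only [← Finset.filter_mem_eq_inter]
  exact Finset.sum_card_bipartiteAbove_eq_sum_card_bipartiteBelow _

lemma mul_card_le_two_mul_remainingCount (σ : EdgeOrdering n) (S : Finset (Fin n)) (i : ℕ) :
    (S ∩ minCoverUnion (KonigProc σ i)).card * (S.card - 1) ≤
      2 * (remainingCount (insidePairs S) σ i + i) := by
  set D := S ∩ minCoverUnion (KonigProc σ i) with hD
  set P := D.sigma fun u => S.erase u with hP
  have hPc : P.card = D.card * (S.card - 1) := by
    rw [hP, Finset.card_sigma, Finset.sum_const_nat]
    intro u hu
    exact Finset.card_erase_of_mem (Finset.mem_inter.1 hu).1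
  set J := Finset.univ.filter fun j : Fin (n*(n-1)/2) =>
    σ.1 j ∈ insidePairs S (KonigProc σ i) with hJ
  have hPJ : P.card ≤ 2 * J.card := by
    have hex : ∀ p ∈ P, ∃ j ∈ J, σ.1 j = s(p.1, p.2) := by
      intro p hp
      obtain ⟨hp1, hp2⟩ := Finset.mem_sigma.1 hp
      obtain ⟨hne, hpS⟩ := Finset.mem_erase.1 hp2
      obtain ⟨j, hj⟩ := σ.exists_eq (e := s(p.1, p.2)) (by simpa using hne.symm)
      exact ⟨j, Finset.mem_filter.2 ⟨Finset.mem_univ _, p.1, hp1, p.2, hpS, hne.symm, hj⟩, hj⟩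
    choose f hf using hex
    rw [← Finset.card_attach (s := P)]
    refine Finset.card_le_mul_card_image_of_maps_to (f := fun p : P => f p.1 p.2)
      (fun p _ => (hf p.1 p.2).1) 2 fun j _ => ?_
    by_contra! hlt
    obtain ⟨p, q, r, hp, hq, hr, hpq, hpr, hqr⟩ := Finset.two_lt_card_iff.1 hlt
    simp only [Finset.mem_filter, Finset.mem_attach, true_and] at hp hq hr
    have h1 := (hf p.1 p.2).2
    have h2 := (hf q.1 q.2).2
    have h3 := (hf r.1 r.2).2
    rw [hp] at h1
    rw [hq] at h2
    rw [hr] at h3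
    obtain ⟨⟨p1, p2⟩, hp'⟩ := p
    obtain ⟨⟨q1, q2⟩, hq'⟩ := q
    obtain ⟨⟨r1, r2⟩, hr'⟩ := r
    have h12 := h1.symm.trans h2
    have h13 := h1.symm.trans h3
    simp only [Sym2.eq_iff, ne_eq, Subtype.mk.injEq, Sigma.mk.injEq, heq_eq_eq] at *
    grind
  have hJr : J.card ≤ remainingCount (insidePairs S) σ i + i := by
    have hsub : J ⊆ (Finset.univ.filter fun j : Fin (n*(n-1)/2) =>
        i ≤ j.1 ∧ σ.1 j ∈ insidePairs S (KonigProc σ i)) ∪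
        Finset.univ.filter fun j : Fin (n*(n-1)/2) => j.1 < i := by
      intro j hj
      simp only [hJ, Finset.mem_union, Finset.mem_filter, Finset.mem_univ, true_and] at hj ⊢
      by_cases h : i ≤ j.1
      · exact Or.inl ⟨h, hj⟩
      · exact Or.inr (by omega)
    refine (Finset.card_le_card hsub).trans ((Finset.card_union_le _ _).trans ?_)
    refine Nat.add_le_add_left ?_ _
    calc _ ≤ (Finset.range i).card :=
          Finset.card_le_card_of_injOn Fin.val (by intro j; simp) (Fin.val_injective.injOn)
      _ = i := Finset.card_range i
  rw [← hPc]
  omega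

lemma remainingCount_uncoveredPairs_le (σ : EdgeOrdering n) (U : Finset (Fin n)) (i : ℕ) :
    remainingCount (uncoveredPairs U) σ i ≤ (U \ minCoverUnion (KonigProc σ i)).card * n := by
  set D := U \ minCoverUnion (KonigProc σ i) with hD
  calc remainingCount (uncoveredPairs U) σ i
      ≤ ((D ×ˢ (Finset.univ : Finset (Fin n))).image fun p => s(p.1, p.2)).card := by
        refine Finset.card_le_card_of_injOn σ.1 ?_ σ.2.1.injOn
        intro j hj
        obtain ⟨-, -, v, hv, hve⟩ := Finset.mem_filter.1 hj
        obtain ⟨u, hu⟩ := hve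
        exact Finset.mem_coe.2 (Finset.mem_image.2 ⟨(v, u), by simp [hD, hv], hu.symm⟩)
    _ ≤ (D ×ˢ (Finset.univ : Finset (Fin n))).card := Finset.card_image_le
    _ = D.card * n := by simp

lemma adj_of_hit_insidePairs {σ : EdgeOrdering n} {S : Finset (Fin n)} {i m : ℕ} (him : i < m)
    (h : Hit (insidePairs S) σ i) : ∃ u ∈ S, ∃ v ∈ S, (KonigProc σ m).Adj u v := by
  obtain ⟨hi, u, hu, v, hv, huv, he⟩ := h
  obtain ⟨huS, huD⟩ := Finset.mem_inter.1 hu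
  refine ⟨u, huS, v, hv, konigProc_mono σ (Nat.succ_le_of_lt him) ?_⟩
  have hK := (isKonig_konigProc σ i).sup_fromEdgeSet (e := s(u, v)) (Sym2.mem_mk_left u v) huD
  unfold KonigProc
  rw [dif_pos hi, he, if_pos hK]
  exact Or.inr ((SimpleGraph.fromEdgeSet_adj _).2 ⟨rfl, huv⟩)

lemma hit_uncoveredPairs_of_rejected {σ : EdgeOrdering n} {U : Finset (Fin n)} {i : ℕ}
    (h : ∃ h : i < n*(n-1)/2, (∃ v ∈ U, v ∈ σ.1 ⟨i, h⟩) ∧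
      ¬ IsKonig (KonigProc σ i ⊔ SimpleGraph.fromEdgeSet {σ.1 ⟨i, h⟩})) :
    Hit (uncoveredPairs U) σ i := by
  obtain ⟨hi, ⟨v, hv, hve⟩, hrej⟩ := h
  refine ⟨hi, v, Finset.mem_sdiff.2 ⟨hv, fun hD => hrej ?_⟩, hve⟩
  exact (isKonig_konigProc σ i).sup_fromEdgeSet hve hD

lemma cast_choose_two (n : ℕ) : ((n*(n-1)/2 : ℕ) : ℝ) = (n : ℝ) * (n - 1) / 2 := by
  rw [← Nat.choose_two_right, Nat.cast_choose_two]

/-- A heavy set that stays independent forces a large weight. -/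
lemma exp_le_hitWeight_insidePairs {m₁ t : ℕ} (hn : 400 ≤ n) (ht : 0 < t)
    (hM : ((m₁ + t : ℕ) : ℝ) ^ 2 ≤ (n : ℝ) ^ 3) (hN : m₁ + t ≤ n*(n-1)/2)
    (σ : EdgeOrdering n) (S : Finset (Fin n)) (hS : (n : ℝ) / 3 ≤ S.card)
    (hW : 150 * (n : ℝ)^2 / t ≤ ((∑ v ∈ S, ((Finset.Ico m₁ (m₁ + t)).filter
      (fun m => v ∈ minCoverUnion (KonigProc σ m))).card : ℕ) : ℝ) / t)
    (hind : ∀ u ∈ S, ∀ v ∈ S, ¬ (KonigProc σ (m₁ + t)).Adj u v) :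
    Real.exp (2 * n) ≤ hitWeight 0 (insidePairs S) σ (Finset.Ico m₁ (m₁ + t)) := by
  have hnR : (400 : ℝ) ≤ n := by exact_mod_cast hn
  have hno : (Finset.Ico m₁ (m₁ + t)).filter (Hit (insidePairs S) σ) = ∅ := by
    refine Finset.filter_eq_empty_iff.2 fun i hi hhit => ?_
    obtain ⟨u, hu, v, hv, huv⟩ := adj_of_hit_insidePairs (Finset.mem_Ico.1 hi).2 hhit
    exact hind u hu v hv huv
  rw [hitWeight_eq, hno, Finset.card_empty, pow_zero, one_mul, Real.exp_le_exp]
  rw [div_le_div_iff_of_pos_right (by exact_mod_cast ht),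
    sum_card_filter_mem_minCoverUnion, Nat.cast_sum] at hW
  set p := ∑ i ∈ Finset.Ico m₁ (m₁ + t), hitProb (insidePairs S) σ i with hp
  have hstep : ∀ i ∈ Finset.Ico m₁ (m₁ + t),
      ((S ∩ minCoverUnion (KonigProc σ i)).card : ℝ) * ((S.card : ℝ) - 1) ≤
        2 * (hitProb (insidePairs S) σ i * ((n : ℝ) * (n - 1) / 2)) +
          2 * ((m₁ + t : ℕ) : ℝ) := by
    intro i hi
    have hi2 := (Finset.mem_Ico.1 hi).2
    have h1 := mul_card_le_two_mul_remainingCount σ S i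
    have hS1 : 1 ≤ S.card := by
      have : (1 : ℝ) ≤ S.card := by linarith
      exact_mod_cast this
    have h2 : ((S ∩ minCoverUnion (KonigProc σ i)).card : ℝ) * ((S.card : ℝ) - 1) ≤
        2 * ((remainingCount (insidePairs S) σ i : ℝ) + i) := by
      have := (Nat.cast_le (α := ℝ)).2 h1
      rw [Nat.cast_mul, Nat.cast_sub hS1] at this
      push_cast at this
      exact this
    rw [remainingCount_eq (by omega), cast_choose_two] at h2
    have hp0 : 0 ≤ hitProb (insidePairs S) σ i * i :=
      mul_nonneg (hitProb_nonneg (by omega) σ) (Nat.cast_nonneg _)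
    have hiM : (i : ℝ) ≤ ((m₁ + t : ℕ) : ℝ) := by exact_mod_cast hi2.le
    linarith
  have hsum := Finset.sum_le_sum hstep
  rw [← Finset.sum_mul, Finset.sum_add_distrib, ← Finset.mul_sum, ← Finset.sum_mul, ← hp,
    Finset.sum_const, Nat.card_Ico, nsmul_eq_mul, Nat.add_sub_cancel_left] at hsum
  have htM : (t : ℝ) ≤ ((m₁ + t : ℕ) : ℝ) := by exact_mod_cast Nat.le_add_left t m₁
  have h3 : (t : ℝ) * (2 * ((m₁ + t : ℕ) : ℝ)) ≤ 2 * (n : ℝ) ^ 3 := by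
    nlinarith [Nat.cast_nonneg (α := ℝ) (m₁ + t)]
  have h4 : 150 * (n : ℝ) ^ 2 * ((n : ℝ) / 3 - 1) ≤
      (∑ i ∈ Finset.Ico m₁ (m₁ + t), ((S ∩ minCoverUnion (KonigProc σ i)).card : ℝ)) *
        ((S.card : ℝ) - 1) :=
    mul_le_mul hW (by linarith) (by linarith) (le_trans (by positivity) hW)
  by_contra! hlt
  have h5 : p * ((n : ℝ) * (n - 1) / 2) ≤ 2 * n * ((n : ℝ) * (n - 1) / 2) :=
    mul_le_mul_of_nonneg_right (by linarith) (by nlinarith)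
  nlinarith [sq_nonneg (n : ℝ), mul_nonneg (sq_nonneg (n : ℝ)) (by linarith : (0 : ℝ) ≤ n - 400)]

/-- Too many rejections at an almost always covered set force a large weight. -/
lemma exp_le_hitWeight_uncoveredPairs {m₁ t : ℕ} (hn : 400 ≤ n) (ht : 0 < t)
    (hM : ((m₁ + t : ℕ) : ℝ) ^ 2 ≤ (n : ℝ) ^ 3) (hN : m₁ + t ≤ n*(n-1)/2)
    (σ : EdgeOrdering n) (U : Finset (Fin n)) (hU : (U.card : ℝ) = (n : ℝ) / 2) {a : ℝ}
    (ha : 10 ≤ a)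
    (hW : (n : ℝ)/2 - a * (n : ℝ)^2 / t ≤ ((∑ v ∈ U, ((Finset.Ico m₁ (m₁ + t)).filter
      (fun m => v ∈ minCoverUnion (KonigProc σ m))).card : ℕ) : ℝ) / t)
    (hrej : 5 * a * n < (((Finset.Ico m₁ (m₁ + t)).filter (fun i => ∃ h : i < n*(n-1)/2,
      (∃ v ∈ U, v ∈ σ.1 ⟨i, h⟩) ∧
      ¬ IsKonig (KonigProc σ i ⊔ SimpleGraph.fromEdgeSet {σ.1 ⟨i, h⟩}))).card : ℝ)) :
    Real.exp (2 * n) ≤ hitWeight 2 (uncoveredPairs U) σ (Finset.Ico m₁ (m₁ + t)) := by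
  have hnR : (400 : ℝ) ≤ n := by exact_mod_cast hn
  have htR : (0 : ℝ) < t := by exact_mod_cast ht
  have hcard : 5 * a * n ≤
      (((Finset.Ico m₁ (m₁ + t)).filter (Hit (uncoveredPairs U) σ)).card : ℝ) := by
    refine hrej.le.trans (Nat.cast_le.2 (Finset.card_le_card ?_))
    exact Finset.monotone_filter_right _ fun i _ hi => hit_uncoveredPairs_of_rejected hi
  rw [hitWeight_eq]
  set X := ((Finset.Ico m₁ (m₁ + t)).filter (Hit (uncoveredPairs U) σ)).card
  set p := ∑ i ∈ Finset.Ico m₁ (m₁ + t), hitProb (uncoveredPairs U) σ i with hp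
  have hpow : (2 : ℝ) ^ X = Real.exp (X * Real.log 2) := by
    rw [Real.exp_nat_mul, Real.exp_log (by norm_num)]
  rw [hpow, ← Real.exp_add, Real.exp_le_exp]
  rw [sum_card_filter_mem_minCoverUnion, Nat.cast_sum, le_div_iff₀ htR, sub_mul,
    div_mul_cancel₀ _ htR.ne'] at hW
  have hdiff : ∑ i ∈ Finset.Ico m₁ (m₁ + t),
      ((U \ minCoverUnion (KonigProc σ i)).card : ℝ) ≤ a * (n : ℝ) ^ 2 := by
    have : ∀ i, ((U \ minCoverUnion (KonigProc σ i)).card : ℝ) =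
        (n : ℝ) / 2 - ((U ∩ minCoverUnion (KonigProc σ i)).card : ℝ) := by
      intro i
      rw [← hU, ← Finset.card_sdiff_add_card_inter U (minCoverUnion (KonigProc σ i))]
      push_cast
      ring
    rw [Finset.sum_congr rfl fun i _ => this i, Finset.sum_sub_distrib, Finset.sum_const,
      Nat.card_Ico, nsmul_eq_mul, Nat.add_sub_cancel_left]
    linarith
  have hMn : ((m₁ + t : ℕ) : ℝ) ≤ (n : ℝ) ^ 2 / 20 := by
    refine (sq_le_sq₀ (Nat.cast_nonneg _) (by positivity)).1 ?_
    nlinarith [mul_nonneg (pow_nonneg (Nat.cast_nonneg (α := ℝ) n) 3)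
      (by linarith : (0 : ℝ) ≤ n - 400)]
  have hstep : ∀ i ∈ Finset.Ico m₁ (m₁ + t), hitProb (uncoveredPairs U) σ i *
      (2 / 5 * (n : ℝ) ^ 2) ≤ ((U \ minCoverUnion (KonigProc σ i)).card : ℝ) * n := by
    intro i hi
    have hi2 := (Finset.mem_Ico.1 hi).2
    have h1 : (remainingCount (uncoveredPairs U) σ i : ℝ) ≤
        ((U \ minCoverUnion (KonigProc σ i)).card : ℝ) * n := by
      exact_mod_cast remainingCount_uncoveredPairs_le σ U i
    rw [remainingCount_eq (by omega), cast_choose_two] at h1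
    have hiM : (i : ℝ) ≤ ((m₁ + t : ℕ) : ℝ) := by exact_mod_cast hi2.le
    refine le_trans (mul_le_mul_of_nonneg_left ?_ (hitProb_nonneg (by omega) σ)) h1
    nlinarith
  have hsum := Finset.sum_le_sum hstep
  rw [← Finset.sum_mul, ← Finset.sum_mul, ← hp] at hsum
  have hp2 : p ≤ 5 / 2 * a * n := by
    have h6 : p * (2 / 5 * (n : ℝ) ^ 2) ≤ 5 / 2 * a * n * (2 / 5 * (n : ℝ) ^ 2) :=
      calc p * (2 / 5 * (n : ℝ) ^ 2) ≤ a * (n : ℝ) ^ 2 * n :=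
            hsum.trans (mul_le_mul_of_nonneg_right hdiff (Nat.cast_nonneg n))
        _ = _ := by ring
    exact le_of_mul_le_mul_right h6 (by positivity)
  have hlog : (5 * a * n) * (69 / 100) ≤ X * Real.log 2 :=
    mul_le_mul hcard (by linarith [Real.log_two_gt_d9]) (by norm_num) (Nat.cast_nonneg X)
  nlinarith [mul_nonneg (by linarith : (0 : ℝ) ≤ a - 10) (by linarith : (0 : ℝ) ≤ n)]

end Targets

/-- Markov's inequality together with a union bound over vertex sets. -/
lemma one_sub_le_Pr {n m₁ t : ℕ} (hN : m₁ + t ≤ n*(n-1)/2) {A : EdgeOrdering n → Prop}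
    (hA : ∀ σ, ¬ A σ → ∃ S : Finset (Fin n),
      Real.exp (2 * n) ≤ hitWeight 0 (insidePairs S) σ (Finset.Ico m₁ (m₁ + t)) ∨
      Real.exp (2 * n) ≤ hitWeight 2 (uncoveredPairs S) σ (Finset.Ico m₁ (m₁ + t))) :
    1 - 2 * Real.exp (-n) ≤ Pr n A := by
  set F : EdgeOrdering n → Finset (Fin n) → ℝ := fun σ S =>
    hitWeight 0 (insidePairs S) σ (Finset.Ico m₁ (m₁ + t)) +
      hitWeight 2 (uncoveredPairs S) σ (Finset.Ico m₁ (m₁ + t)) with hF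
  have h0 : ∀ (S : Finset (Fin n)) σ,
      0 ≤ hitWeight 0 (insidePairs S) σ (Finset.Ico m₁ (m₁ + t)) :=
    fun S σ => hitWeight_nonneg le_rfl _ _
  have h2 : ∀ (S : Finset (Fin n)) σ,
      0 ≤ hitWeight 2 (uncoveredPairs S) σ (Finset.Ico m₁ (m₁ + t)) :=
    fun S σ => hitWeight_nonneg zero_le_two _ _
  have hbad : ((Finset.univ.filter fun σ => ¬ A σ).card : ℝ) * Real.exp (2 * n) ≤
      2 ^ n * (2 * Fintype.card (EdgeOrdering n)) :=
    calc _ = ∑ σ with ¬ A σ, Real.exp (2 * n) := by rw [Finset.sum_const, nsmul_eq_mul]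
      _ ≤ ∑ σ with ¬ A σ, ∑ S, F σ S := by
          refine Finset.sum_le_sum fun σ hσ => ?_
          obtain ⟨S, hS⟩ := hA σ (Finset.mem_filter.1 hσ).2
          have hFS : Real.exp (2 * n) ≤ F σ S := by
            rcases hS with hS | hS
            · exact hS.trans (le_add_of_nonneg_right (h2 S σ))
            · exact hS.trans (le_add_of_nonneg_left (h0 S σ))
          exact hFS.trans (Finset.single_le_sum (f := F σ)
            (fun S _ => add_nonneg (h0 S σ) (h2 S σ)) (Finset.mem_univ S))
      _ ≤ ∑ σ, ∑ S, F σ S :=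
          Finset.sum_le_sum_of_subset_of_nonneg (Finset.filter_subset _ _) fun σ _ _ =>
            Finset.sum_nonneg fun S _ => add_nonneg (h0 S σ) (h2 S σ)
      _ = ∑ S, ∑ σ, F σ S := Finset.sum_comm
      _ ≤ ∑ _S : Finset (Fin n), 2 * (Fintype.card (EdgeOrdering n) : ℝ) := by
          refine Finset.sum_le_sum fun S _ => ?_
          rw [hF, Finset.sum_add_distrib, two_mul]
          exact add_le_add (sum_hitWeight_le le_rfl m₁ t hN)
            (sum_hitWeight_le zero_le_two m₁ t hN)
      _ = _ := by simp
  have hcpos : (0 : ℝ) < Fintype.card (EdgeOrdering n) := by exact_mod_cast Fintype.card_pos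
  have hexp : (2 : ℝ) ^ n ≤ Real.exp n := by
    calc (2 : ℝ) ^ n ≤ Real.exp 1 ^ n :=
          pow_le_pow_left₀ zero_le_two (by linarith [Real.add_one_le_exp (1 : ℝ)]) n
      _ = Real.exp n := by rw [← Real.exp_nat_mul, mul_one]
  have hbad2 : ((Finset.univ.filter fun σ => ¬ A σ).card : ℝ) ≤
      2 * Real.exp (-n) * Fintype.card (EdgeOrdering n) := by
    refine le_of_mul_le_mul_right (hbad.trans ?_) (Real.exp_pos (2 * n))
    have : Real.exp (-n) * Real.exp (2 * n) = Real.exp n := by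
      rw [← Real.exp_add]; congr 1; ring
    calc (2 : ℝ) ^ n * (2 * Fintype.card (EdgeOrdering n))
        ≤ Real.exp n * (2 * Fintype.card (EdgeOrdering n)) :=
          mul_le_mul_of_nonneg_right hexp (by positivity)
      _ = _ := by rw [← this]; ring
  have hsplit : ((Finset.univ.filter fun σ => A σ).card : ℝ) +
      (Finset.univ.filter fun σ => ¬ A σ).card = Fintype.card (EdgeOrdering n) := by
    exact_mod_cast Finset.card_filter_add_card_filter_not (s := Finset.univ) (fun σ => A σ)
  rw [Pr, Nat.card_eq_fintype_card, Nat.card_eq_fintype_card, Fintype.card_subtype,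
    le_div_iff₀ hcpos]
  linarith

lemma Pr_le_one (n : ℕ) (A : EdgeOrdering n → Prop) : Pr n A ≤ 1 := by
  refine div_le_one_of_le₀ (Nat.cast_le.2 ?_) (Nat.cast_nonneg _)
  exact Nat.card_le_card_of_injective _ Subtype.val_injective

lemma eventually_period_bounds {γ : ℝ} (hγ : 0 < γ) {m₁ : ℕ → ℕ}
    (hm₁ : Filter.Tendsto (fun k : ℕ => (m₁ k : ℝ) / ((2*k) * Real.log (2*k)))
      Filter.atTop (nhds 0)) :
    ∀ᶠ k : ℕ in Filter.atTop, 400 ≤ 2 * k ∧ 0 < ⌊γ * (2 * k : ℕ) * Real.log (2 * k : ℕ)⌋₊ ∧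
      ((m₁ k + ⌊γ * (2 * k : ℕ) * Real.log (2 * k : ℕ)⌋₊ : ℕ) : ℝ) ^ 2 ≤
        ((2 * k : ℕ) : ℝ) ^ 3 := by
  have hcast : Filter.Tendsto (fun k : ℕ => (2 * (k : ℝ))) Filter.atTop Filter.atTop :=
    tendsto_natCast_atTop_atTop.const_mul_atTop two_pos
  have hlog := Real.tendsto_log_atTop.comp hcast
  have hlittle := (isLittleO_log_rpow_atTop (r := 1 / 2) (by norm_num)).def
    (c := 1 / (γ + 1)) (by positivity)
  filter_upwards [Filter.eventually_ge_atTop 200, hm₁.eventually_lt_const one_pos,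
    hcast.eventually hlittle, hlog.eventually_ge_atTop 1,
    hcast.eventually_ge_atTop (1 / γ)] with k hk hm hl hl1 hkγ
  push_cast
  simp only [Function.comp_apply] at hl1
  have hk0 : (400 : ℝ) ≤ 2 * k := by
    have : (200 : ℝ) ≤ k := by exact_mod_cast hk
    linarith
  set x : ℝ := 2 * k with hx
  have hx0 : 0 < x := by linarith
  have hγx : 1 ≤ γ * x := by
    rw [div_le_iff₀ hγ] at hkγ
    linarith
  have hfl : (⌊γ * x * Real.log x⌋₊ : ℝ) ≤ γ * x * Real.log x :=
    Nat.floor_le (by positivity)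
  have hml : (m₁ k : ℝ) ≤ x * Real.log x := by
    rw [div_lt_one (by positivity)] at hm
    exact hm.le
  refine ⟨by omega, Nat.floor_pos.2 (by nlinarith), ?_⟩
  have hroot : (x ^ (1 / 2 : ℝ)) ^ 2 = x := by
    rw [← Real.sqrt_eq_rpow, Real.sq_sqrt hx0.le]
  rw [Real.norm_of_nonneg (by linarith), Real.norm_of_nonneg (Real.rpow_nonneg hx0.le _),
    one_div_mul_eq_div, le_div_iff₀ (by positivity)] at hl
  calc ((m₁ k : ℝ) + ⌊γ * x * Real.log x⌋₊) ^ 2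
      ≤ (x * x ^ (1 / 2 : ℝ)) ^ 2 := by
        refine pow_le_pow_left₀ (by positivity) ?_ 2
        calc _ ≤ x * (Real.log x * (γ + 1)) := by linarith
          _ ≤ _ := mul_le_mul_of_nonneg_left hl hx0.le
    _ = x ^ 3 := by rw [mul_pow, hroot]; ring

/-- Lemma on rigidity of covers during a period `T = T(m₁, ⌊γ n log n⌋)` with
`m₁ = o(n log n)`. Whp: (1) no set `S` with `|S| ≥ n/3` and average weight
`W_T(S) ≥ 150 n²/t` is independent in `G_{m₁+t}`; and (2) for every `a ≥ 10` and every set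
`U` of order `n/2` with `W_T(U) ≥ n/2 − a n²/t`, at most `5an` offered pairs incident to `U`
are rejected during `T+1`. -/
theorem koenig_process_cover_control (γ : ℝ) (hγ : 0 < γ) (m₁ : ℕ → ℕ)
    (hm₁ : Filter.Tendsto (fun k : ℕ => (m₁ k : ℝ) / ((2*k) * Real.log (2*k)))
      Filter.atTop (nhds 0)) :
    Filter.Tendsto (fun k : ℕ =>
      Pr (2*k) (fun σ =>
        let n : ℕ := 2*k
        let t : ℕ := ⌊γ * n * Real.log n⌋₊
        let T : Finset ℕ := Finset.Ico (m₁ k) (m₁ k + t)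
        let W : Finset (Fin n) → ℝ := fun S =>
          ((∑ v ∈ S, (T.filter (fun m => v ∈ minCoverUnion (KonigProc σ m))).card : ℕ) : ℝ) / t
        (∀ S : Finset (Fin n), (n : ℝ)/3 ≤ S.card → 150 * (n : ℝ)^2 / t ≤ W S →
          ¬ ∀ u ∈ S, ∀ v ∈ S, ¬ (KonigProc σ (m₁ k + t)).Adj u v) ∧
        (∀ a : ℝ, 10 ≤ a → ∀ U : Finset (Fin n), U.card = n/2 →
          (n : ℝ)/2 - a * (n : ℝ)^2 / t ≤ W U →
          ((T.filter (fun i => ∃ h : i < n*(n-1)/2,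
              (∃ v ∈ U, v ∈ σ.1 ⟨i, h⟩) ∧
              ¬ IsKonig (KonigProc σ i ⊔ SimpleGraph.fromEdgeSet {σ.1 ⟨i, h⟩}))).card : ℝ)
            ≤ 5 * a * n)))
      Filter.atTop (nhds 1) := by
  have hlow : Filter.Tendsto (fun k : ℕ => 1 - 2 * Real.exp (-((2 * k : ℕ) : ℝ)))
      Filter.atTop (nhds 1) := by
    have h2k : Filter.Tendsto (fun k : ℕ => ((2 * k : ℕ) : ℝ)) Filter.atTop Filter.atTop :=
      tendsto_natCast_atTop_atTop.comp
        (Filter.tendsto_id.const_mul_atTop' two_pos)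
    have := ((Real.tendsto_exp_neg_atTop_nhds_zero.comp h2k).const_mul 2).const_sub 1
    simpa using this
  refine tendsto_of_tendsto_of_tendsto_of_le_of_le' hlow tendsto_const_nhds ?_
    (Filter.Eventually.of_forall fun k => Pr_le_one _ _)
  filter_upwards [eventually_period_bounds hγ hm₁] with k hk
  obtain ⟨hn, ht, hM⟩ := hk
  have hN : m₁ k + ⌊γ * (2 * k : ℕ) * Real.log (2 * k : ℕ)⌋₊ ≤ 2*k*(2*k-1)/2 := by
    have hnR : (400 : ℝ) ≤ ((2 * k : ℕ) : ℝ) := by exact_mod_cast hn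
    rw [← Nat.cast_le (α := ℝ), cast_choose_two]
    refine (sq_le_sq₀ (Nat.cast_nonneg _) (by nlinarith)).1 (hM.trans ?_)
    generalize ((2 * k : ℕ) : ℝ) = x at hnR
    have hx : x / 4 ≤ (x - 1) / 2 := by linarith
    nlinarith [mul_le_mul hx hx (by linarith) (by linarith), sq_nonneg x,
      mul_nonneg (mul_nonneg (sq_nonneg x) (by linarith : (0 : ℝ) ≤ x))
        (by linarith : (0 : ℝ) ≤ x - 400)]
  refine one_sub_le_Pr hN fun σ hσ => ?_
  by_contra! hnone
  refine hσ ⟨fun S hS hW hind => ?_, fun a ha U hU hW => ?_⟩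
  · exact absurd (exp_le_hitWeight_insidePairs hn ht hM hN σ S hS hW hind)
      (not_le.2 (hnone S).1)
  · by_contra! hrej
    refine absurd (exp_le_hitWeight_uncoveredPairs hn ht hM hN σ U ?_ ha hW hrej)
      (not_le.2 (hnone U).2)
    rw [hU, Nat.mul_div_cancel_left k two_pos]
    push_cast
    ring
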